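/- Fix integers N ≥ 1, p ≥ 2, reals β and γ̃ > 0, and set θ = tanh β. Define the cavity function Ψ_N(γ̃,β,t) = Σ_{k,k′} e^{−γ̃N}(γ̃N)^k/k! · e^{−2γ̃t}(2γ̃t)^{k′}/k′! · N^{−pk} N^{−(p−1)k′} Σ_{I:{1,…,k}→{1,…,N}^p} Σ_{L:{1,…,k′}→{1,…,N}^{p−1}} ln( Z_{N,t}(I,L,β) / Z_N(I,β) ). Then t ↦ Ψ_N(γ̃,β,t) is differentiable for t > 0 and dΨ_N/dt = 2γ̃ [ ln cosh β + E_t( N^{−(p−1)} Σ_{(i_1,…,i_{p−1})∈{1,…,N}^{p−1}} ln(1 + θ ω_{I,L}(σ_{i_1}⋯σ_{i_{p−1}})) ) ], where ω_{I,L} is the Gibbs state with weight w_{I,L}(σ) = exp(β Σ_{ν=1}^k Π_{j=1}^p σ_{I(ν,j)} + β Σ_{μ=1}^{k′} Π_{j=1}^{p−1} σ_{L(μ,j)}) and E_t denotes the quenched average over (k, I, k′, L). -/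

import Mathlib

open scoped BigOperators

noncomputable section

/-- The value of a Boolean spin: `true ↦ 1`, `false ↦ -1`. -/
def spin (b : Bool) : ℝ := if b then 1 else -1

/-- Poisson probability mass function with mean `c`. -/
def poisProb (c : ℝ) (k : ℕ) : ℝ := Real.exp (-c) * c ^ k / (Nat.factorial k)

/-- Diluted p-spin energy (minus the Hamiltonian) for an index family `I`. -/
def energy (N p k : ℕ) (I : Fin k → Fin p → Fin N) (σ : Fin N → Bool) : ℝ :=
  ∑ ν : Fin k, ∏ j : Fin p, spin (σ (I ν j))

/-- Diluted p-spin partition function `Z_N(I, β)`. -/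
def Zdil (N p k : ℕ) (β : ℝ) (I : Fin k → Fin p → Fin N) : ℝ :=
  ∑ σ : Fin N → Bool, Real.exp (β * energy N p k I σ)

/-- Perturbed Gibbs weight `w_{I,L}(σ)`. -/
def gibbsWeight (N p k k' : ℕ) (β : ℝ) (I : Fin k → Fin p → Fin N)
    (L : Fin k' → Fin (p - 1) → Fin N) (σ : Fin N → Bool) : ℝ :=
  Real.exp (β * energy N p k I σ + β * energy N (p - 1) k' L σ)

/-- Perturbed partition function `Z_{N,t}(I, L, β)`. -/
def Zpert (N p k k' : ℕ) (β : ℝ) (I : Fin k → Fin p → Fin N)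
    (L : Fin k' → Fin (p - 1) → Fin N) : ℝ :=
  ∑ σ : Fin N → Bool, gibbsWeight N p k k' β I L σ

/-- Gibbs state `ω(g)` for a weight `w`. -/
def gibbsAvg (N : ℕ) (w : (Fin N → Bool) → ℝ) (g : (Fin N → Bool) → ℝ) : ℝ :=
  (∑ σ : Fin N → Bool, g σ * w σ) / ∑ σ : Fin N → Bool, w σ

/-- Quenched average over `k ∼ Poisson(gN)`, `k' ∼ Poisson(2gt)` and i.i.d. uniform
index families `I`, `L`. -/
def quenchedPert (N p : ℕ) (g t : ℝ)
    (f : (k : ℕ) → (k' : ℕ) → (Fin k → Fin p → Fin N) →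
      (Fin k' → Fin (p - 1) → Fin N) → ℝ) : ℝ :=
  ∑' k : ℕ, ∑' k' : ℕ,
    poisProb (g * N) k * poisProb (2 * g * t) k' *
      ((N : ℝ) ^ (p * k))⁻¹ * ((N : ℝ) ^ ((p - 1) * k'))⁻¹ *
      ∑ I : Fin k → Fin p → Fin N, ∑ L : Fin k' → Fin (p - 1) → Fin N, f k k' I L

/-- Cavity function `Ψ_N(g, β, t)`. -/
def cavity (N p : ℕ) (β g t : ℝ) : ℝ :=
  quenchedPert N p g t (fun k k' I L =>
    Real.log (Zpert N p k k' β I L / Zdil N p k β I))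

section PoissonSeries

lemma poisProb_nonneg {c : ℝ} (hc : 0 ≤ c) (k : ℕ) : 0 ≤ poisProb c k := by
  unfold poisProb; positivity

lemma hasSum_poisProb (c : ℝ) : HasSum (poisProb c) 1 := by
  have h := (NormedSpace.expSeries_div_hasSum_exp c).mul_left (Real.exp (-c))
  rw [← Real.exp_eq_exp_ℝ, ← Real.exp_add, neg_add_cancel, Real.exp_zero] at h
  exact h.congr_fun fun n => by simp [poisProb, mul_div_assoc]

lemma summable_pow_div_factorial_mul {a : ℕ → ℝ} {C : ℝ} (ha : ∀ n, |a n| ≤ C * 2 ^ n) (x : ℝ) :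
    Summable fun n : ℕ => x ^ n / (Nat.factorial n) * a n := by
  refine Summable.of_norm_bounded ((Real.summable_pow_div_factorial (2 * |x|)).mul_left C) ?_
  intro n
  rw [Real.norm_eq_abs, abs_mul, abs_div, abs_pow, Nat.abs_cast]
  calc |x| ^ n / (Nat.factorial n) * |a n| ≤ |x| ^ n / (Nat.factorial n) * (C * 2 ^ n) := by
        gcongr; exact ha n
    _ = _ := by rw [mul_pow]; ring

/-- Differentiating an exponential generating function shifts its coefficients. -/
lemma hasDerivAt_tsum_pow_div_factorial {a : ℕ → ℝ} {C : ℝ} (ha : ∀ n, |a n| ≤ C * 2 ^ n)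
    (x : ℝ) :
    HasDerivAt (fun y : ℝ => ∑' n : ℕ, y ^ n / (Nat.factorial n) * a n)
      (∑' n : ℕ, x ^ n / (Nat.factorial n) * a (n + 1)) x := by
  set R : ℝ := |x| + 1
  have hR : 1 ≤ R := by simp [R]
  have hC : 0 ≤ C := by simpa using (abs_nonneg _).trans (ha 0)
  have hsum (y : ℝ) : Summable fun n : ℕ => y ^ n / (Nat.factorial n) * a n :=
    summable_pow_div_factorial_mul ha y
  have key := hasDerivAt_tsum_of_isPreconnected (𝕜 := ℝ) (F := ℝ)
    (u := fun n : ℕ => C * ((4 * R) ^ n / (Nat.factorial n)))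
    (g := fun n y => y ^ n / (Nat.factorial n) * a n)
    (g' := fun n y => n * y ^ (n - 1) / (Nat.factorial n) * a n)
    (t := Metric.ball 0 R) (y₀ := x) (y := x)
    ((Real.summable_pow_div_factorial (4 * R)).mul_left C) Metric.isOpen_ball
    (convex_ball 0 R).isPreconnected
    (fun n y _ => ((hasDerivAt_pow n y).div_const _).mul_const _)
    (by
      intro n y hy
      have hy' : |y| ≤ R := by simpa using (mem_ball_zero_iff.1 hy).le
      rw [Real.norm_eq_abs, abs_mul, abs_div, abs_mul, abs_pow, Nat.abs_cast, Nat.abs_cast]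
      have h1 : |y| ^ (n - 1) ≤ R ^ n :=
        (pow_le_pow_left₀ (abs_nonneg _) hy' _).trans (pow_le_pow_right₀ hR (Nat.sub_le _ _))
      have h2 : (n : ℝ) ≤ 2 ^ n := by exact_mod_cast Nat.lt_two_pow_self.le
      calc (n : ℝ) * |y| ^ (n - 1) / (Nat.factorial n) * |a n|
          ≤ 2 ^ n * R ^ n / (Nat.factorial n) * (C * 2 ^ n) := by
            gcongr; exact ha n
        _ = _ := by
            rw [mul_pow, show (4 : ℝ) = 2 * 2 by norm_num, mul_pow]; ring)
    (by simp [R]) (hsum x) (by simp [R])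
  convert! key using 1
  have hs : Summable fun n : ℕ => (n : ℝ) * x ^ (n - 1) / (Nat.factorial n) * a n := by
    rw [← summable_nat_add_iff 1]
    refine (summable_pow_div_factorial_mul (a := fun n => a (n + 1)) (C := C * 2)
      (fun n => (ha (n + 1)).trans_eq (by ring)) x).congr fun n => ?_
    rw [Nat.factorial_succ, Nat.add_sub_cancel]; push_cast; field_simp
  rw [hs.tsum_eq_zero_add]
  simp only [Nat.cast_zero, zero_mul, zero_div, zero_add]
  refine tsum_congr fun n => ?_
  rw [Nat.factorial_succ, Nat.add_sub_cancel]; push_cast; field_simp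

lemma summable_poisProb_mul {a : ℕ → ℝ} {C : ℝ} (ha : ∀ n, |a n| ≤ C * 2 ^ n) (c : ℝ) :
    Summable fun n : ℕ => poisProb c n * a n :=
  ((summable_pow_div_factorial_mul ha c).mul_left (Real.exp (-c))).congr fun n => by
    rw [poisProb]; ring

/-- Differentiating a Poisson expectation in the mean gives the expected forward difference. -/
lemma hasDerivAt_tsum_poisProb_mul {a : ℕ → ℝ} {C : ℝ} (ha : ∀ n, |a n| ≤ C * 2 ^ n) (c : ℝ) :
    HasDerivAt (fun x : ℝ => ∑' n : ℕ, poisProb x n * a n)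
      (∑' n : ℕ, poisProb c n * (a (n + 1) - a n)) c := by
  have hsucc : ∀ n, |a (n + 1)| ≤ C * 2 * 2 ^ n := fun n => (ha (n + 1)).trans_eq (by ring)
  have heq (b : ℕ → ℝ) (x : ℝ) : ∑' n : ℕ, poisProb x n * b n =
      Real.exp (-x) * ∑' n : ℕ, x ^ n / (Nat.factorial n) * b n := by
    rw [← tsum_mul_left]
    exact tsum_congr fun n => by rw [poisProb]; ring
  have h := ((hasDerivAt_neg c).exp).mul (hasDerivAt_tsum_pow_div_factorial ha c)
  convert! h using 1
  · exact funext fun x => heq a x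
  · simp only [mul_sub]
    rw [(summable_poisProb_mul hsucc c).tsum_sub (summable_poisProb_mul ha c), heq, heq a]
    ring

lemma tsum_poisProb_mul_comm {A : ℕ → ℕ → ℝ} {C : ℝ} (hA : ∀ k n, |A k n| ≤ C * 2 ^ n)
    {b : ℝ} (c : ℝ) :
    ∑' k : ℕ, ∑' n : ℕ, poisProb b k * poisProb c n * A k n =
      ∑' n : ℕ, poisProb c n * ∑' k : ℕ, poisProb b k * A k n := by
  have hC : 0 ≤ C := by simpa using (abs_nonneg _).trans (hA 0 0)
  have h1 : Summable fun k => |poisProb b k| := (hasSum_poisProb b).summable.abs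
  have h2 : Summable fun n => |poisProb c n * (C * 2 ^ n)| :=
    (summable_poisProb_mul (C := C) (fun n => by rw [abs_of_nonneg]; positivity) c).abs
  have hs : Summable (Function.uncurry fun k n => poisProb b k * poisProb c n * A k n) := by
    refine Summable.of_norm_bounded (h1.mul_of_nonneg h2 (fun _ => abs_nonneg _)
      (fun _ => abs_nonneg _)) ?_
    rintro ⟨k, n⟩
    simp only [Function.uncurry, Real.norm_eq_abs, abs_mul, mul_assoc]
    gcongr
    rw [← abs_mul C, abs_of_nonneg (a := C * _) (by positivity)]
    exact hA k n
  rw [← hs.tsum_comm]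
  refine tsum_congr fun n => ?_
  rw [← tsum_mul_left]
  exact tsum_congr fun k => by ring

/-- Differentiating a double Poisson expectation in the second mean. -/
lemma hasDerivAt_tsum_tsum_poisProb_mul {A B : ℕ → ℕ → ℝ} {C ℓ : ℝ}
    (hA : ∀ k n, |A k n| ≤ C * 2 ^ n) (hAB : ∀ k n, A k (n + 1) - A k n = ℓ + B k n)
    {b : ℝ} (hb : 0 ≤ b) (c : ℝ) :
    HasDerivAt (fun x : ℝ => ∑' k : ℕ, ∑' n : ℕ, poisProb b k * poisProb x n * A k n)
      (ℓ + ∑' k : ℕ, ∑' n : ℕ, poisProb b k * poisProb c n * B k n) c := by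
  have hB : ∀ k n, |B k n| ≤ (3 * C + |ℓ|) * 2 ^ n := by
    intro k n
    have h1 := hA k (n + 1)
    have h2 := hA k n
    have h3 : |ℓ| ≤ |ℓ| * 2 ^ n :=
      le_mul_of_one_le_right (abs_nonneg _) (one_le_pow₀ (by norm_num))
    have h4 : B k n = A k (n + 1) - A k n - ℓ := by linarith [hAB k n]
    calc |B k n| ≤ |A k (n + 1)| + |A k n| + |ℓ| := by
          rw [h4]; exact (abs_sub _ _).trans (by gcongr; exact abs_sub _ _)
      _ ≤ _ := by rw [pow_succ] at h1; linarith
  have hsumk {D : ℕ → ℕ → ℝ} {M : ℝ} (hD : ∀ k n, |D k n| ≤ M * 2 ^ n) (n : ℕ) :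
      Summable fun k => poisProb b k * D k n := by
    refine summable_poisProb_mul (C := M * 2 ^ n) (fun k => (hD k n).trans ?_) b
    exact le_mul_of_one_le_right ((abs_nonneg _).trans (hD k n)) (one_le_pow₀ (by norm_num))
  have hbar {D : ℕ → ℕ → ℝ} {M : ℝ} (hD : ∀ k n, |D k n| ≤ M * 2 ^ n) (n : ℕ) :
      |∑' k, poisProb b k * D k n| ≤ M * 2 ^ n := by
    have h := ((hasSum_poisProb b).mul_right (M * 2 ^ n))
    rw [one_mul] at h
    rw [← Real.norm_eq_abs]
    refine tsum_of_norm_bounded h fun k => ?_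
    rw [Real.norm_eq_abs, abs_mul, abs_of_nonneg (poisProb_nonneg hb k)]
    exact mul_le_mul_of_nonneg_left (hD k n) (poisProb_nonneg hb k)
  have h := hasDerivAt_tsum_poisProb_mul (hbar hA) c
  simp only [tsum_poisProb_mul_comm hA]
  convert! h using 1
  have hdiff (n : ℕ) : (∑' k, poisProb b k * A k (n + 1)) - ∑' k, poisProb b k * A k n =
      ℓ + ∑' k, poisProb b k * B k n := by
    rw [← (hsumk hA _).tsum_sub (hsumk hA _)]
    have h0 := ((hasSum_poisProb b).mul_right ℓ).add (hsumk hB n).hasSum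
    rw [one_mul] at h0
    rw [← h0.tsum_eq]
    exact tsum_congr fun k => by rw [← mul_sub, hAB, mul_add]
  simp only [hdiff]
  rw [tsum_poisProb_mul_comm hB]
  have h0 := ((hasSum_poisProb c).mul_right ℓ).add (summable_poisProb_mul (hbar hB) c).hasSum
  rw [one_mul] at h0
  rw [← h0.tsum_eq]
  exact tsum_congr fun n => by rw [mul_add]

end PoissonSeries

section Gibbs

lemma abs_prod_spin_le {n N : ℕ} (σ : Fin N → Bool) (ι : Fin n → Fin N) :
    |∏ j, spin (σ (ι j))| ≤ 1 := by
  rw [Finset.abs_prod]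
  exact Finset.prod_le_one (fun _ _ => abs_nonneg _) fun j _ => by
    unfold spin; split_ifs <;> simp

lemma prod_spin_eq_one_or {n N : ℕ} (σ : Fin N → Bool) (ι : Fin n → Fin N) :
    ∏ j, spin (σ (ι j)) = 1 ∨ ∏ j, spin (σ (ι j)) = -1 := by
  refine Finset.prod_induction _ (fun x : ℝ => x = 1 ∨ x = -1) ?_ (Or.inl rfl) fun j _ => ?_
  · rintro a b (rfl | rfl) (rfl | rfl) <;> simp
  · unfold spin; split_ifs <;> simp

lemma abs_energy_le (N p k : ℕ) (I : Fin k → Fin p → Fin N) (σ : Fin N → Bool) :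
    |energy N p k I σ| ≤ k := by
  refine (Finset.abs_sum_le_sum_abs _ _).trans ?_
  exact (Finset.sum_le_sum fun ν _ => abs_prod_spin_le σ (I ν)).trans_eq (by simp)

lemma energy_cons (N p k : ℕ) (ι : Fin p → Fin N) (I : Fin k → Fin p → Fin N)
    (σ : Fin N → Bool) :
    energy N p (k + 1) (Fin.cons ι I) σ = (∏ j, spin (σ (ι j))) + energy N p k I σ := by
  simp [energy, Fin.sum_univ_succ]

lemma Zdil_pos (N p k : ℕ) (β : ℝ) (I : Fin k → Fin p → Fin N) : 0 < Zdil N p k β I :=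
  Finset.sum_pos (fun _ _ => Real.exp_pos _) Finset.univ_nonempty

lemma Zpert_pos (N p k k' : ℕ) (β : ℝ) (I : Fin k → Fin p → Fin N)
    (L : Fin k' → Fin (p - 1) → Fin N) : 0 < Zpert N p k k' β I L :=
  Finset.sum_pos (fun _ _ => Real.exp_pos _) Finset.univ_nonempty

lemma abs_log_Zpert_div_Zdil_le (N p k k' : ℕ) (β : ℝ) (I : Fin k → Fin p → Fin N)
    (L : Fin k' → Fin (p - 1) → Fin N) :
    |Real.log (Zpert N p k k' β I L / Zdil N p k β I)| ≤ |β| * k' := by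
  have hZ := Zdil_pos N p k β I
  have hE (σ : Fin N → Bool) : |β * energy N (p - 1) k' L σ| ≤ |β| * k' := by
    rw [abs_mul]; gcongr; exact abs_energy_le _ _ _ _ _
  rw [abs_le]
  constructor
  · rw [Real.le_log_iff_exp_le (div_pos (Zpert_pos ..) hZ), le_div_iff₀ hZ, Zdil, Finset.mul_sum]
    refine Finset.sum_le_sum fun σ _ => ?_
    rw [gibbsWeight, ← Real.exp_add, Real.exp_le_exp]
    linarith [(abs_le.1 (hE σ)).1]
  · rw [Real.log_le_iff_le_exp (div_pos (Zpert_pos ..) hZ), div_le_iff₀ hZ, Zdil, Finset.mul_sum]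
    refine Finset.sum_le_sum fun σ _ => ?_
    rw [gibbsWeight, ← Real.exp_add, Real.exp_le_exp]
    linarith [(abs_le.1 (hE σ)).2]

lemma exp_mul_eq_cosh_mul {s : ℝ} (hs : s = 1 ∨ s = -1) (β : ℝ) :
    Real.exp (β * s) = Real.cosh β * (1 + Real.tanh β * s) := by
  have h := (Real.cosh_pos β).ne'
  rw [Real.tanh_eq_sinh_div_cosh]
  rcases hs with rfl | rfl
  · rw [mul_one, ← Real.cosh_add_sinh]; field_simp
  · rw [mul_neg_one, ← Real.cosh_sub_sinh]; field_simp; ring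

/-- Adding one `(p - 1)`-spin interaction multiplies the partition function by a Gibbs average. -/
lemma Zpert_cons (N p k k' : ℕ) (β : ℝ) (I : Fin k → Fin p → Fin N)
    (L : Fin k' → Fin (p - 1) → Fin N) (ι : Fin (p - 1) → Fin N) :
    Zpert N p k (k' + 1) β I (Fin.cons ι L) =
      Real.cosh β * (1 + Real.tanh β * gibbsAvg N (gibbsWeight N p k k' β I L)
        (fun σ => ∏ j, spin (σ (ι j)))) * Zpert N p k k' β I L := by
  have hZ : (∑ σ, gibbsWeight N p k k' β I L σ) ≠ 0 := (Zpert_pos N p k k' β I L).ne'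
  have h (σ : Fin N → Bool) : gibbsWeight N p k (k' + 1) β I (Fin.cons ι L) σ =
      Real.cosh β * (gibbsWeight N p k k' β I L σ +
        Real.tanh β * ((∏ j, spin (σ (ι j))) * gibbsWeight N p k k' β I L σ)) := by
    rw [gibbsWeight, gibbsWeight, energy_cons, mul_add, add_left_comm, Real.exp_add,
      exp_mul_eq_cosh_mul (prod_spin_eq_one_or σ ι)]
    ring
  simp only [Zpert, gibbsAvg, h]
  rw [← Finset.mul_sum, Finset.sum_add_distrib, ← Finset.mul_sum]
  field_simp

lemma log_Zpert_cons_div_Zdil (N p k k' : ℕ) (β : ℝ) (I : Fin k → Fin p → Fin N)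
    (L : Fin k' → Fin (p - 1) → Fin N) (ι : Fin (p - 1) → Fin N) :
    Real.log (Zpert N p k (k' + 1) β I (Fin.cons ι L) / Zdil N p k β I) =
      Real.log (Real.cosh β) + Real.log (1 + Real.tanh β *
        gibbsAvg N (gibbsWeight N p k k' β I L) (fun σ => ∏ j, spin (σ (ι j)))) +
      Real.log (Zpert N p k k' β I L / Zdil N p k β I) := by
  have h := Zpert_pos N p k (k' + 1) β I (Fin.cons ι L)
  rw [Zpert_cons] at h ⊢
  rw [mul_div_assoc, Real.log_mul (left_ne_zero_of_mul h.ne')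
    (div_pos (Zpert_pos ..) (Zdil_pos ..)).ne', Real.log_mul (Real.cosh_pos β).ne'
    (right_ne_zero_of_mul (left_ne_zero_of_mul h.ne'))]

end Gibbs

section UniformAverage

/-- The average over i.i.d. uniform index families of fixed sizes `k` and `k'`. -/
def indexAvg (N p k k' : ℕ)
    (f : (Fin k → Fin p → Fin N) → (Fin k' → Fin (p - 1) → Fin N) → ℝ) : ℝ :=
  ((N : ℝ) ^ (p * k))⁻¹ * ((N : ℝ) ^ ((p - 1) * k'))⁻¹ * ∑ I, ∑ L, f I L

lemma quenchedPert_eq (N p : ℕ) (g t : ℝ)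
    (f : (k : ℕ) → (k' : ℕ) → (Fin k → Fin p → Fin N) →
      (Fin k' → Fin (p - 1) → Fin N) → ℝ) :
    quenchedPert N p g t f = ∑' k : ℕ, ∑' k' : ℕ,
      poisProb (g * N) k * poisProb (2 * g * t) k' * indexAvg N p k k' (f k k') := by
  simp only [quenchedPert, indexAvg, mul_assoc]

lemma indexAvg_const {N : ℕ} (hN : N ≠ 0) (p k k' : ℕ) (c : ℝ) :
    indexAvg N p k k' (fun _ _ => c) = c := by
  have h : (N : ℝ) ≠ 0 := by exact_mod_cast hN
  simp only [indexAvg, Finset.sum_const, Finset.card_univ, Fintype.card_fun, Fintype.card_fin,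
    nsmul_eq_mul, Nat.cast_pow, ← pow_mul]
  field_simp

lemma indexAvg_add (N p k k' : ℕ)
    (f h : (Fin k → Fin p → Fin N) → (Fin k' → Fin (p - 1) → Fin N) → ℝ) :
    indexAvg N p k k' (fun I L => f I L + h I L) =
      indexAvg N p k k' f + indexAvg N p k k' h := by
  simp only [indexAvg, Finset.sum_add_distrib, mul_add]

lemma abs_indexAvg_le {N : ℕ} (hN : N ≠ 0) {p k k' : ℕ}
    {f : (Fin k → Fin p → Fin N) → (Fin k' → Fin (p - 1) → Fin N) → ℝ} {c : ℝ}
    (hf : ∀ I L, |f I L| ≤ c) : |indexAvg N p k k' f| ≤ c := by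
  conv_rhs => rw [← indexAvg_const hN p k k' c]
  rw [indexAvg, indexAvg, abs_mul, abs_of_nonneg (by positivity)]
  gcongr
  refine (Finset.abs_sum_le_sum_abs _ _).trans (Finset.sum_le_sum fun I _ => ?_)
  exact (Finset.abs_sum_le_sum_abs _ _).trans (Finset.sum_le_sum fun L _ => hf I L)

lemma indexAvg_succ (N p k k' : ℕ)
    (f : (Fin k → Fin p → Fin N) → (Fin (k' + 1) → Fin (p - 1) → Fin N) → ℝ) :
    indexAvg N p k (k' + 1) f = indexAvg N p k k' (fun I L =>
      ((N : ℝ) ^ (p - 1))⁻¹ * ∑ ι : Fin (p - 1) → Fin N, f I (Fin.cons ι L)) := by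
  have h (I : Fin k → Fin p → Fin N) : ∑ L, f I L =
      ∑ L : Fin k' → Fin (p - 1) → Fin N, ∑ ι : Fin (p - 1) → Fin N, f I (Fin.cons ι L) := by
    rw [← (Fin.consEquiv fun _ : Fin (k' + 1) => Fin (p - 1) → Fin N).sum_comp,
      Fintype.sum_prod_type, Finset.sum_comm]
    rfl
  simp only [indexAvg, h, ← Finset.mul_sum]
  rw [mul_add_one (p - 1) k', pow_add, mul_inv]
  ring

end UniformAverage

/-- **The t-derivative of the cavity function** (eq. (20) of the paper, before the
logarithm is expanded in multi-overlaps):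
`dΨ_N/dt = 2γ̃ [ln cosh β + E_t(N^{-(p-1)} Σ_ι ln(1 + θ ω_{I,L}(σ_{i₁}⋯σ_{i_{p-1}})))]`. -/
theorem cavity_deriv (N p : ℕ) (hN : 1 ≤ N) (hp : 2 ≤ p)
    (β g : ℝ) (hg : 0 < g) (t : ℝ) (ht : 0 < t) :
    HasDerivAt (fun u : ℝ => cavity N p β g u)
      (2 * g *
        (Real.log (Real.cosh β) +
          quenchedPert N p g t (fun k k' I L =>
            ((N : ℝ) ^ (p - 1))⁻¹ * ∑ ι : Fin (p - 1) → Fin N,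
              Real.log (1 + Real.tanh β *
                gibbsAvg N (gibbsWeight N p k k' β I L)
                  (fun σ => ∏ j : Fin (p - 1), spin (σ (ι j)))))))
      t := by
  have hN0 : N ≠ 0 := by omega
  have hA (k n : ℕ) : |indexAvg N p k n (fun I L =>
      Real.log (Zpert N p k n β I L / Zdil N p k β I))| ≤ |β| * 2 ^ n := by
    refine abs_indexAvg_le hN0 fun I L => (abs_log_Zpert_div_Zdil_le ..).trans ?_
    gcongr
    exact_mod_cast Nat.lt_two_pow_self.le
  have hAB (k n : ℕ) : indexAvg N p k (n + 1) (fun I L =>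
        Real.log (Zpert N p k (n + 1) β I L / Zdil N p k β I)) -
      indexAvg N p k n (fun I L => Real.log (Zpert N p k n β I L / Zdil N p k β I)) =
      Real.log (Real.cosh β) + indexAvg N p k n (fun I L =>
        ((N : ℝ) ^ (p - 1))⁻¹ * ∑ ι : Fin (p - 1) → Fin N,
          Real.log (1 + Real.tanh β * gibbsAvg N (gibbsWeight N p k n β I L)
            (fun σ => ∏ j : Fin (p - 1), spin (σ (ι j))))) := by
    rw [indexAvg_succ, sub_eq_iff_eq_add, ← indexAvg_const hN0 p k n (Real.log (Real.cosh β)),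
      ← indexAvg_add, ← indexAvg_add]
    congr 1
    funext I L
    simp only [log_Zpert_cons_div_Zdil, Finset.sum_add_distrib, Finset.sum_const,
      Finset.card_univ, Fintype.card_fun, Fintype.card_fin, nsmul_eq_mul, Nat.cast_pow]
    field_simp
  have hd := (hasDerivAt_tsum_tsum_poisProb_mul hA hAB (b := g * N) (by positivity)
    (2 * g * t)).comp t ((hasDerivAt_id t).const_mul (2 * g))
  simp only [cavity, quenchedPert_eq]
  convert! hd using 1
  ring
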